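/- Let 1 ≤ m ≤ p be integers and P ∈ ℝ^{p×m} a matrix with PᵀP = I_m. Let q be a centered random vector in ℝ^m on a probability space with E[‖q‖₂²] < ∞ whose covariance matrix Σ_q is invertible, let y be a real random variable on the same space with E[y²] < ∞, and set x := P q (so that Σ_x = P Σ_q Pᵀ and Σ_{x,y} = P Σ_{q,y}). Then β := P Σ_q⁻¹ Σ_{q,y} is the unique vector ζ ∈ range(Σ_x) with Σ_x ζ = Σ_{x,y}, and β is the unique minimizer of ζ ↦ ‖Σ_x ζ − Σ_{x,y}‖₂ over the Krylov space K_m(Σ_x, Σ_{x,y}); that is, the PLS solution with parameter s = m coincides with the minimum-norm least-squares solution P Σ_q⁻¹ Σ_{q,y}. -/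

import Mathlib

open MeasureTheory Matrix

/-- The Euclidean norm `‖v‖₂ = √(∑ i, v i ^ 2)` on `ℝ^p`. -/
noncomputable def euclNorm {p : ℕ} (v : Fin p → ℝ) : ℝ :=
  Real.sqrt (∑ i, v i ^ 2)

/-- The Krylov space `K_s(A,b) := span{b, A b, …, A^{s−1} b} ⊆ ℝ^p`. -/
def krylov {p : ℕ} (A : Matrix (Fin p) (Fin p) ℝ) (b : Fin p → ℝ) (s : ℕ) :
    Submodule ℝ (Fin p → ℝ) :=
  Submodule.span ℝ ((fun k => (A ^ k).mulVec b) '' Set.Iio s)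

/-- The covariance matrix `Σ_x := (E[x_i x_j])_{i,j}` of a random vector `x : Ω → ℝ^p`. -/
noncomputable def covMatrix {Ω : Type*} [MeasurableSpace Ω] (μ : Measure Ω) {p : ℕ}
    (x : Ω → Fin p → ℝ) : Matrix (Fin p) (Fin p) ℝ :=
  Matrix.of fun i j => ∫ ω, x ω i * x ω j ∂μ

/-- The covariance vector `Σ_{x,y} := (E[x_i y])_i ∈ ℝ^p`. -/
noncomputable def covVector {Ω : Type*} [MeasurableSpace Ω] (μ : Measure Ω) {p : ℕ}
    (x : Ω → Fin p → ℝ) (y : Ω → ℝ) : Fin p → ℝ :=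
  fun i => ∫ ω, x ω i * y ω ∂μ

theorem aux_cov_matrix {p m : ℕ} (P : Matrix (Fin p) (Fin m) ℝ)
    {Ω : Type*} [MeasurableSpace Ω] (μ : Measure Ω) (q : Ω → Fin m → ℝ)
    (hq : ∀ i, MemLp (fun ω => q ω i) 2 μ) :
    covMatrix μ (fun ω => P.mulVec (q ω)) = P * covMatrix μ q * Pᵀ := by
  have hI : ∀ a b, Integrable (fun ω => q ω a * q ω b) μ := fun a b =>
    (hq a).integrable_mul (hq b)
  ext i j
  simp only [covMatrix, Matrix.of_apply, Matrix.mul_apply, Matrix.mulVec, dotProduct,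
    Matrix.transpose_apply]
  have h1 : ∀ ω, (∑ a, P i a * q ω a) * (∑ b, P j b * q ω b)
      = ∑ b, ∑ a, (P i a * P j b) * (q ω a * q ω b) := by
    intro ω
    rw [Finset.sum_mul_sum, Finset.sum_comm]
    refine Finset.sum_congr rfl fun b _ => Finset.sum_congr rfl fun a _ => by ring
  simp_rw [h1]
  rw [integral_finsetSum _ fun b _ => integrable_finsetSum _ fun a _ => (hI a b).const_mul _]
  refine Finset.sum_congr rfl fun b _ => ?_
  rw [integral_finsetSum _ fun a _ => (hI a b).const_mul _, Finset.sum_mul]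
  refine Finset.sum_congr rfl fun a _ => ?_
  rw [integral_const_mul]
  ring

theorem aux_cov_vector {p m : ℕ} (P : Matrix (Fin p) (Fin m) ℝ)
    {Ω : Type*} [MeasurableSpace Ω] (μ : Measure Ω) (q : Ω → Fin m → ℝ) (y : Ω → ℝ)
    (hq : ∀ i, MemLp (fun ω => q ω i) 2 μ) (hy : MemLp y 2 μ) :
    covVector μ (fun ω => P.mulVec (q ω)) y = P.mulVec (covVector μ q y) := by
  have hI : ∀ a, Integrable (fun ω => q ω a * y ω) μ := fun a => (hq a).integrable_mul hy
  ext i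
  simp only [covVector, Matrix.mulVec, dotProduct, Finset.sum_mul, mul_assoc]
  rw [integral_finsetSum _ fun a _ => (hI a).const_mul _]
  refine Finset.sum_congr rfl fun a _ => ?_
  rw [integral_const_mul]

theorem aux_inv {m : ℕ} (hm : 1 ≤ m) (S : Matrix (Fin m) (Fin m) ℝ) (hS : IsUnit S.det) :
    ∃ f : ℕ → ℝ, S⁻¹ = ∑ k ∈ Finset.range m, f k • S ^ k := by
  have hne : Nonempty (Fin m) := ⟨⟨0, hm⟩⟩
  have hch := Matrix.aeval_self_charpoly S
  have hdeg : S.charpoly.natDegree = m := by simp [Matrix.charpoly_natDegree_eq_dim]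
  have hc0 : S.charpoly.coeff 0 ≠ 0 := by
    intro h
    have := Matrix.det_eq_sign_charpoly_coeff S
    rw [h, mul_zero] at this
    exact hS.ne_zero this
  have hd : S.charpoly.divX.natDegree < m := by
    rw [Polynomial.natDegree_divX_eq_natDegree_tsub_one, hdeg]; omega
  rw [← Polynomial.X_mul_divX_add S.charpoly] at hch
  simp only [map_add, map_mul, Polynomial.aeval_X, Polynomial.aeval_C] at hch
  refine ⟨fun k => -(S.charpoly.coeff 0)⁻¹ * S.charpoly.divX.coeff k, ?_⟩
  have hs : ∑ k ∈ Finset.range m, (-(S.charpoly.coeff 0)⁻¹ * S.charpoly.divX.coeff k) • S ^ k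
      = (-(S.charpoly.coeff 0)⁻¹) • Polynomial.aeval S S.charpoly.divX := by
    rw [Polynomial.aeval_eq_sum_range' hd, Finset.smul_sum]
    simp only [smul_smul]
  rw [hs]
  apply Matrix.inv_eq_right_inv
  rw [Matrix.mul_smul, eq_neg_of_add_eq_zero_left hch, Algebra.algebraMap_eq_smul_one]
  rw [← neg_smul, smul_smul, neg_mul_neg, inv_mul_cancel₀ hc0, one_smul]

theorem aux_euclNorm_zero {p : ℕ} (v : Fin p → ℝ) (h : euclNorm v ≤ 0) : v = 0 := by
  unfold euclNorm at h
  have h0 : ∑ i, v i ^ 2 ≤ 0 := Real.sqrt_eq_zero'.1 (le_antisymm h (Real.sqrt_nonneg _))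
  have h1 := (Finset.sum_eq_zero_iff_of_nonneg (fun i _ => sq_nonneg (v i))).1
    (le_antisymm h0 (Finset.sum_nonneg fun i _ => sq_nonneg (v i)))
  ext i
  simpa using h1 i (Finset.mem_univ i)

theorem aux_linear {p m : ℕ} (hm : 1 ≤ m)
    (P : Matrix (Fin p) (Fin m) ℝ) (hP : Pᵀ * P = 1)
    (S : Matrix (Fin m) (Fin m) ℝ) (c : Fin m → ℝ) (hS : IsUnit S.det)
    (A : Matrix (Fin p) (Fin p) ℝ) (b β : Fin p → ℝ)
    (hA : A = P * S * Pᵀ) (hb : b = P.mulVec c) (hβ : β = P.mulVec (S⁻¹.mulVec c)) :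
    (β ∈ Set.range A.mulVec ∧ A.mulVec β = b ∧
      ∀ ζ : Fin p → ℝ, ζ ∈ Set.range A.mulVec → A.mulVec ζ = b → ζ = β) ∧
    (β ∈ krylov A b m ∧
      (∀ ζ ∈ krylov A b m, euclNorm (A.mulVec β - b) ≤ euclNorm (A.mulVec ζ - b)) ∧
      ∀ ζ ∈ krylov A b m,
        (∀ ζ' ∈ krylov A b m,
          euclNorm (A.mulVec ζ - b) ≤ euclNorm (A.mulVec ζ' - b)) → ζ = β) := by
  have hPP : ∀ u, Pᵀ.mulVec (P.mulVec u) = u := fun u => by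
    rw [Matrix.mulVec_mulVec, hP, Matrix.one_mulVec]
  have hAP : ∀ u, A.mulVec (P.mulVec u) = P.mulVec (S.mulVec u) := fun u => by
    rw [hA, ← Matrix.mulVec_mulVec, hPP, Matrix.mulVec_mulVec]
  have hSi : ∀ u, S.mulVec (S⁻¹.mulVec u) = u := fun u => by
    rw [Matrix.mulVec_mulVec, Matrix.mul_nonsing_inv _ hS, Matrix.one_mulVec]
  have hiS : ∀ u, S⁻¹.mulVec (S.mulVec u) = u := fun u => by
    rw [Matrix.mulVec_mulVec, Matrix.nonsing_inv_mul _ hS, Matrix.one_mulVec]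
  have hAβ : A.mulVec β = b := by rw [hβ, hAP, hSi, hb]
  have hun : ∀ u, A.mulVec (P.mulVec u) = b → P.mulVec u = β := by
    intro u hu
    rw [hAP, hb] at hu
    have h2 := congrArg Pᵀ.mulVec hu
    rw [hPP, hPP] at h2
    rw [hβ, ← h2, hiS]
  have hpow : ∀ k : ℕ, (A ^ k).mulVec b = P.mulVec ((S ^ k).mulVec c) := by
    intro k
    induction k with
    | zero => simp [hb]
    | succ k ih =>
      rw [pow_succ', ← Matrix.mulVec_mulVec, ih, hAP, pow_succ' S, ← Matrix.mulVec_mulVec]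
  have hmem : β ∈ krylov A b m := by
    obtain ⟨f, hf⟩ := aux_inv hm S hS
    have : β = ∑ k ∈ Finset.range m, f k • (A ^ k).mulVec b := by
      rw [hβ, hf, Matrix.sum_mulVec, Matrix.mulVec_sum]
      refine Finset.sum_congr rfl fun k _ => ?_
      rw [hpow, Matrix.smul_mulVec, Matrix.mulVec_smul]
    rw [this]
    refine Submodule.sum_mem _ fun k hk => Submodule.smul_mem _ _ (Submodule.subset_span ?_)
    exact ⟨k, Finset.mem_range.1 hk, rfl⟩
  have hrange : ∀ ζ ∈ krylov A b m, ∃ u, P.mulVec u = ζ := by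
    have : krylov A b m ≤ LinearMap.range P.mulVecLin := by
      refine Submodule.span_le.2 ?_
      rintro _ ⟨k, _, rfl⟩
      exact ⟨(S ^ k).mulVec c, (hpow k).symm⟩
    intro ζ hζ
    exact this hζ
  have h0 : euclNorm (A.mulVec β - b) = 0 := by
    rw [hAβ, sub_self]; simp [euclNorm]
  refine ⟨⟨⟨P.mulVec (S⁻¹.mulVec (S⁻¹.mulVec c)), ?_⟩, hAβ, ?_⟩, hmem, ?_, ?_⟩
  · rw [hAP, hSi, hβ]
  · rintro _ ⟨w, rfl⟩ h
    have hw : A.mulVec w = P.mulVec (S.mulVec (Pᵀ.mulVec w)) := by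
      rw [hA, ← Matrix.mulVec_mulVec, ← Matrix.mulVec_mulVec]
    rw [hw] at h ⊢
    exact hun _ h
  · intro ζ _
    rw [h0]; exact Real.sqrt_nonneg _
  · intro ζ hζ h
    obtain ⟨u, rfl⟩ := hrange ζ hζ
    have h1 := h β hmem
    rw [h0] at h1
    exact hun u (sub_eq_zero.1 (aux_euclNorm_zero _ h1))

/-- Latent factor model: with `x := P q`, `P ∈ ℝ^{p×m}`, `PᵀP = I_m`, `q` centered
square-integrable with invertible covariance `Σ_q`, and `y` square-integrable, the vector
`β := P Σ_q⁻¹ Σ_{q,y}` is the unique `ζ ∈ range(Σ_x)` with `Σ_x ζ = Σ_{x,y}`, and it is also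
the unique minimizer of `ζ ↦ ‖Σ_x ζ − Σ_{x,y}‖₂` over the Krylov space `K_m(Σ_x, Σ_{x,y})`:
the PLS solution with parameter `s = m` coincides with the minimum-norm least-squares
solution. -/
theorem pls_eq_minNorm_ls_latentFactor
    {p m : ℕ} (hm : 1 ≤ m) (hmp : m ≤ p)
    (P : Matrix (Fin p) (Fin m) ℝ) (hP : Pᵀ * P = 1)
    {Ω : Type*} [MeasurableSpace Ω] (μ : Measure Ω) [IsProbabilityMeasure μ]
    (q : Ω → Fin m → ℝ) (y : Ω → ℝ)
    (hq : ∀ i, MemLp (fun ω => q ω i) 2 μ)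
    (hqcen : ∀ i, ∫ ω, q ω i ∂μ = 0)
    (hy : MemLp y 2 μ)
    (hSq : IsUnit (covMatrix μ q).det) :
    let x : Ω → Fin p → ℝ := fun ω => P.mulVec (q ω)
    let β : Fin p → ℝ := P.mulVec ((covMatrix μ q)⁻¹.mulVec (covVector μ q y))
    (β ∈ Set.range (covMatrix μ x).mulVec ∧
      (covMatrix μ x).mulVec β = covVector μ x y ∧
      ∀ ζ : Fin p → ℝ, ζ ∈ Set.range (covMatrix μ x).mulVec →
        (covMatrix μ x).mulVec ζ = covVector μ x y → ζ = β) ∧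
    (β ∈ krylov (covMatrix μ x) (covVector μ x y) m ∧
      (∀ ζ ∈ krylov (covMatrix μ x) (covVector μ x y) m,
        euclNorm ((covMatrix μ x).mulVec β - covVector μ x y)
          ≤ euclNorm ((covMatrix μ x).mulVec ζ - covVector μ x y)) ∧
      ∀ ζ ∈ krylov (covMatrix μ x) (covVector μ x y) m,
        (∀ ζ' ∈ krylov (covMatrix μ x) (covVector μ x y) m,
          euclNorm ((covMatrix μ x).mulVec ζ - covVector μ x y)
            ≤ euclNorm ((covMatrix μ x).mulVec ζ' - covVector μ x y)) → ζ = β) := by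
  intro x β
  exact aux_linear hm P hP (covMatrix μ q) (covVector μ q y) hSq _ _ _
    (aux_cov_matrix P μ q hq) (aux_cov_vector P μ q y hq hy) rfl
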